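/- For any integer m ≥ 2, the formal power series (in z and q, allowing negative powers of z) (1 + z + z² + ... + z^{m-1}) · ∏_{n=1}^∞ (1 - q^n)/((1 - z q^n)(1 - z^{-1} q^n)) has nonnegative coefficients. -/

import Mathlib

open Filter Topology

/-- The coefficient `(a; q)_j / (q; q)_j` of the `q`-binomial series. -/
noncomputable def qBinomCoeff (a q : ℂ) (j : ℕ) : ℂ :=
  ∏ i ∈ Finset.range j, (1 - a * q ^ i) / (1 - q ^ (i + 1))

lemma one_sub_ne_zero_of_norm_lt_one {w : ℂ} (hw : ‖w‖ < 1) : 1 - w ≠ 0 := by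
  intro h
  rw [← sub_eq_zero.mp h] at hw
  simp at hw

lemma one_sub_pow_succ_ne_zero {q : ℂ} (hq : ‖q‖ < 1) (n : ℕ) : 1 - q ^ (n + 1) ≠ 0 := by
  apply one_sub_ne_zero_of_norm_lt_one
  rw [norm_pow]
  exact pow_lt_one₀ (norm_nonneg _) hq (Nat.succ_ne_zero n)

lemma norm_mul_pow_lt_one {q t : ℂ} (hq : ‖q‖ < 1) (ht : ‖t‖ < 1) (n : ℕ) :
    ‖t * q ^ n‖ < 1 := by
  rw [norm_mul, norm_pow]
  exact mul_lt_one_of_nonneg_of_lt_one_left (norm_nonneg _) ht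
    (pow_le_one₀ (norm_nonneg _) hq.le)

lemma tendsto_mul_pow_zero {q : ℂ} (hq : ‖q‖ < 1) (t : ℂ) :
    Tendsto (fun n : ℕ => t * q ^ n) atTop (𝓝 0) := by
  simpa using (tendsto_pow_atTop_nhds_zero_of_norm_lt_one hq).const_mul t

lemma summable_qBinomCoeff {q t : ℂ} (a : ℂ) (hq : ‖q‖ < 1) (ht : ‖t‖ < 1) :
    Summable fun j => qBinomCoeff a q j * t ^ j := by
  obtain ⟨r, htr, hr⟩ := exists_between ht
  have hlim : Tendsto (fun j : ℕ => ‖(1 - a * q ^ j) / (1 - q ^ (j + 1)) * t‖) atTop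
      (𝓝 ‖t‖) := by
    have h1 : Tendsto (fun j : ℕ => 1 - a * q ^ j) atTop (𝓝 (1 - 0)) :=
      (tendsto_mul_pow_zero hq a).const_sub 1
    have h2 : Tendsto (fun j : ℕ => 1 - q ^ (j + 1)) atTop (𝓝 (1 - 0)) :=
      (((tendsto_add_atTop_iff_nat 1).mpr
        (tendsto_pow_atTop_nhds_zero_of_norm_lt_one hq))).const_sub 1
    simpa using ((h1.div h2 (by simp)).mul_const t).norm
  refine summable_of_ratio_norm_eventually_le hr ?_
  filter_upwards [hlim.eventually_le_const htr] with j hj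
  rw [qBinomCoeff, Finset.prod_range_succ, ← qBinomCoeff,
    show ∀ x y : ℂ, x * y * t ^ (j + 1) = y * t * (x * t ^ j) by intros; ring, norm_mul]
  gcongr

/-- The functional equation of the `q`-binomial series. -/
lemma qBinom_functional_eq {q t : ℂ} (a : ℂ) (hq : ‖q‖ < 1) (ht : ‖t‖ < 1) :
    (1 - t) * ∑' j, qBinomCoeff a q j * t ^ j =
      (1 - a * t) * ∑' j, qBinomCoeff a q j * (t * q) ^ j := by
  have htq : ‖t * q‖ < 1 := by simpa using norm_mul_pow_lt_one hq ht 1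
  have s1 := summable_qBinomCoeff a hq ht
  have s2 := summable_qBinomCoeff a hq htq
  have key : ∑' j, (qBinomCoeff a q (j + 1) * t ^ (j + 1)
      - qBinomCoeff a q (j + 1) * (t * q) ^ (j + 1)) =
      ∑' j, (t * (qBinomCoeff a q j * t ^ j) - a * t * (qBinomCoeff a q j * (t * q) ^ j)) := by
    congr 1
    ext j
    have := one_sub_pow_succ_ne_zero hq j
    rw [qBinomCoeff, Finset.prod_range_succ, ← qBinomCoeff]
    field_simp
    ring
  rw [((summable_nat_add_iff 1).mpr s1).tsum_sub ((summable_nat_add_iff 1).mpr s2),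
    (s1.mul_left t).tsum_sub (s2.mul_left (a * t)), tsum_mul_left, tsum_mul_left] at key
  have e1 := s1.tsum_eq_zero_add
  have e2 := s2.tsum_eq_zero_add
  simp only [pow_zero] at e1 e2
  linear_combination e1 - e2 + key

lemma qBinom_iterate {q t : ℂ} (a : ℂ) (hq : ‖q‖ < 1) (ht : ‖t‖ < 1) (N : ℕ) :
    (∏ n ∈ Finset.range N, (1 - t * q ^ n)) * ∑' j, qBinomCoeff a q j * t ^ j =
      (∏ n ∈ Finset.range N, (1 - a * (t * q ^ n))) *
        ∑' j, qBinomCoeff a q j * (t * q ^ N) ^ j := by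
  induction N with
  | zero => simp
  | succ N ih =>
    have := qBinom_functional_eq a hq (norm_mul_pow_lt_one hq ht N)
    rw [mul_assoc t, ← pow_succ] at this
    rw [Finset.prod_range_succ, Finset.prod_range_succ]
    linear_combination (1 - t * q ^ N) * ih +
      (∏ n ∈ Finset.range N, (1 - a * (t * q ^ n))) * this

/-- The `q`-binomial theorem, as convergence of the partial products. -/
lemma tendsto_prod_qBinom {q t : ℂ} (a : ℂ) (hq : ‖q‖ < 1) (ht : ‖t‖ < 1) :
    Tendsto (fun N : ℕ => ∏ n ∈ Finset.range N, (1 - a * (t * q ^ n)) / (1 - t * q ^ n)) atTop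
      (𝓝 (∑' j, qBinomCoeff a q j * t ^ j)) := by
  have hlim : Tendsto (fun N : ℕ => ∑' j, qBinomCoeff a q j * (t * q ^ N) ^ j) atTop (𝓝 1) := by
    have hone : ∑' j, qBinomCoeff a q j * (0 : ℂ) ^ j = 1 := by
      rw [tsum_eq_single 0 (fun j hj => by simp [hj])]
      simp [qBinomCoeff]
    rw [← hone]
    refine tendsto_tsum_of_dominated_convergence (summable_qBinomCoeff a hq ht).norm
      (fun j => ((tendsto_mul_pow_zero hq t).pow j).const_mul _) (.of_forall fun N j => ?_)
    rw [norm_mul, norm_mul, norm_pow, norm_pow, norm_mul, norm_pow]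
    gcongr
    exact mul_le_of_le_one_right (norm_nonneg _) (pow_le_one₀ (norm_nonneg _) hq.le)
  have hne : ∀ N : ℕ, ∏ n ∈ Finset.range N, (1 - t * q ^ n) ≠ 0 := fun N =>
    Finset.prod_ne_zero_iff.mpr fun n _ =>
      one_sub_ne_zero_of_norm_lt_one (norm_mul_pow_lt_one hq ht n)
  have hdiv := (tendsto_const_nhds (x := ∑' j, qBinomCoeff a q j * t ^ j)).div hlim one_ne_zero
  rw [div_one] at hdiv
  refine hdiv.congr' ?_
  filter_upwards [hlim.eventually_ne one_ne_zero] with N hN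
  rw [Finset.prod_div_distrib, Pi.div_apply, div_eq_div_iff hN (hne N), mul_comm]
  exact qBinom_iterate a hq ht N

lemma multipliable_one_sub_mul_pow {q : ℂ} (hq : ‖q‖ < 1) (t : ℂ) :
    Multipliable fun n : ℕ => 1 - t * q ^ n := by
  simp_rw [sub_eq_add_neg]
  apply multipliable_one_add_of_summable
  simpa [norm_mul] using (summable_geometric_of_lt_one (norm_nonneg q) hq).mul_left ‖t‖

lemma tprod_one_sub_mul_pow_ne_zero {q t : ℂ} (hq : ‖q‖ < 1) (ht : ‖t‖ < 1) :
    ∏' n : ℕ, (1 - t * q ^ n) ≠ 0 := by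
  simp_rw [sub_eq_add_neg]
  refine tprod_one_add_ne_zero_of_summable (f := fun n => -(t * q ^ n)) (fun n => ?_) ?_
  · rw [← sub_eq_add_neg]
    exact one_sub_ne_zero_of_norm_lt_one (norm_mul_pow_lt_one hq ht n)
  · simpa [norm_mul] using (summable_geometric_of_lt_one (norm_nonneg q) hq).mul_left ‖t‖

/-- The crank generating function as a product of two `q`-binomial series. -/
lemma crank_tprod_eq {z q : ℂ} (hz : z ≠ 0) (hq : ‖q‖ < 1) (hzq : ‖z * q‖ < 1)
    (hzq' : ‖z⁻¹ * q‖ < 1) :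
    ∏' n : ℕ, (1 - q ^ (n + 1)) / ((1 - z * q ^ (n + 1)) * (1 - z⁻¹ * q ^ (n + 1))) =
      (1 - q) * (∑' j, qBinomCoeff (z * q) q j * (z⁻¹ * q) ^ j) *
        ∑' j, qBinomCoeff 0 q j * (z * q) ^ j := by
  have e : ∀ n : ℕ, (1 - q ^ (n + 1)) / ((1 - z * q ^ (n + 1)) * (1 - z⁻¹ * q ^ (n + 1))) =
      (1 - q * q ^ n) / ((1 - z * q * q ^ n) * (1 - z⁻¹ * q * q ^ n)) := fun n => by
    simp only [pow_succ', mul_assoc]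
  simp_rw [e]
  have m1 := multipliable_one_sub_mul_pow hq q
  have m2 := multipliable_one_sub_mul_pow hq (z * q)
  have m3 := multipliable_one_sub_mul_pow hq (z⁻¹ * q)
  have hne : ∏' n : ℕ, ((1 - z * q * q ^ n) * (1 - z⁻¹ * q * q ^ n)) ≠ 0 := by
    rw [m2.tprod_mul m3]
    exact mul_ne_zero (tprod_one_sub_mul_pow_ne_zero hq hzq)
      (tprod_one_sub_mul_pow_ne_zero hq hzq')
  have hm := (m1.div₀ (m2.mul m3) hne).hasProd.tendsto_prod_nat
  have hA := tendsto_prod_qBinom (z * q) hq hzq'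
  have hB := tendsto_prod_qBinom 0 hq hzq
  have hC : Tendsto (fun N : ℕ => (1 - q * q ^ N)) atTop (𝓝 (1 - 0)) :=
    (tendsto_mul_pow_zero hq q).const_sub 1
  have hL := hm.mul hC
  rw [sub_zero, mul_one] at hL
  refine tendsto_nhds_unique hL (((hA.const_mul (1 - q)).mul hB).congr fun N => ?_)
  have hshift : (∏ n ∈ Finset.range N, (1 - z * q * (z⁻¹ * q * q ^ n))) * (1 - q) =
      (∏ n ∈ Finset.range N, (1 - q * q ^ n)) * (1 - q * q ^ N) := by
    rw [← Finset.prod_range_succ, Finset.prod_range_succ']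
    simp only [pow_zero, mul_one]
    congr 1
    refine Finset.prod_congr rfl fun n _ => ?_
    field_simp
    ring
  simp only [Finset.prod_div_distrib, Finset.prod_mul_distrib, zero_mul, sub_zero,
    Finset.prod_const_one]
  linear_combination ((∏ n ∈ Finset.range N, (1 - z * q * q ^ n)) *
    ∏ n ∈ Finset.range N, (1 - z⁻¹ * q * q ^ n))⁻¹ * hshift

/-- The product `∏_{i < k} 1 / (1 - q ^ (i + s + 1))`. -/
noncomputable def invPowProd (s : ℕ) (q : ℂ) (k : ℕ) : ℂ :=
  ∏ i ∈ Finset.range k, (1 - q ^ (i + s + 1))⁻¹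

lemma qBinomCoeff_zero_eq (q : ℂ) (j : ℕ) : qBinomCoeff 0 q j = invPowProd 0 q j := by
  simp [qBinomCoeff, invPowProd]

lemma one_sub_mul_invPowProd_succ {q : ℂ} (hq : ‖q‖ < 1) (k : ℕ) :
    (1 - q) * invPowProd 0 q (k + 1) = invPowProd 1 q k := by
  have : 1 - q ≠ 0 := one_sub_ne_zero_of_norm_lt_one hq
  rw [invPowProd, Finset.prod_range_succ', invPowProd]
  simp only [zero_add, pow_one, add_zero]
  field_simp

lemma summable_invPowProd {q t : ℂ} (hq : ‖q‖ < 1) (ht : ‖t‖ < 1) :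
    Summable fun k => invPowProd 0 q k * t ^ k := by
  simpa only [qBinomCoeff_zero_eq] using summable_qBinomCoeff 0 hq ht

lemma summable_invPowProd_one {q t : ℂ} (hq : ‖q‖ < 1) (ht : ‖t‖ < 1) :
    Summable fun k => invPowProd 1 q k * t ^ (k + 1) := by
  simpa only [← one_sub_mul_invPowProd_succ hq, mul_assoc] using
    ((summable_nat_add_iff 1).mpr (summable_invPowProd hq ht)).mul_left (1 - q)

/-- Euler's series `∑ t ^ k / (q; q)_k`. -/
noncomputable def eulerSeries (q t : ℂ) : ℂ := ∑' k, invPowProd 0 q k * t ^ k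

lemma eulerSeries_eq_one_add {q t : ℂ} (hq : ‖q‖ < 1) (ht : ‖t‖ < 1) :
    eulerSeries q t = 1 + ∑' k, invPowProd 0 q (k + 1) * t ^ (k + 1) := by
  rw [eulerSeries, (summable_invPowProd hq ht).tsum_eq_zero_add]
  simp [invPowProd]

lemma qBinomCoeff_mul_eulerSeries {q t : ℂ} (hq : ‖q‖ < 1) (ht : ‖t‖ < 1) (j : ℕ) :
    qBinomCoeff t q j * eulerSeries q t = invPowProd 0 q j * eulerSeries q (t * q ^ j) := by
  have h := qBinom_iterate 0 hq ht j
  simp only [qBinomCoeff_zero_eq, zero_mul, sub_zero, Finset.prod_const_one, one_mul] at h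
  rw [eulerSeries, eulerSeries, ← h, qBinomCoeff, invPowProd, ← mul_assoc, Finset.prod_div_distrib,
    Finset.prod_inv_distrib]
  simp only [add_zero]
  ring

lemma summable_invPowProd_one_mul_eulerSeries {q t y : ℂ} (hq : ‖q‖ < 1) (ht : ‖t‖ < 1)
    (hy : ‖y‖ < 1) :
    Summable fun j => invPowProd 1 q j * y ^ (j + 1) * eulerSeries q (t * q ^ (j + 1)) := by
  refine (((summable_nat_add_iff 1).mpr (summable_qBinomCoeff t hq hy)).mul_left
    ((1 - q) * eulerSeries q t)).congr fun j => ?_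
  rw [← one_sub_mul_invPowProd_succ hq]
  linear_combination (1 - q) * y ^ (j + 1) * qBinomCoeff_mul_eulerSeries hq ht (j + 1)

/-- Expansion of the product of the two series in the crank generating function. -/
lemma crank_series_eq {q t y : ℂ} (hq : ‖q‖ < 1) (ht : ‖t‖ < 1) (hy : ‖y‖ < 1) :
    (1 - q) * (∑' j, qBinomCoeff t q j * y ^ j) * eulerSeries q t =
      1 - q + t + y + ∑' k, invPowProd 1 q (k + 1) * t ^ (k + 2) +
        y * ∑' k, invPowProd 0 q (k + 1) * (t * q) ^ (k + 1) +
        ∑' j, invPowProd 1 q (j + 1) * y ^ (j + 2) * eulerSeries q (t * q ^ (j + 2)) := by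
  have htq : ‖t * q‖ < 1 := by simpa using norm_mul_pow_lt_one hq ht 1
  have h1 : (1 - q) * (∑' j, qBinomCoeff t q j * y ^ j) * eulerSeries q t =
      (1 - q) * eulerSeries q t +
        ∑' j, invPowProd 1 q j * y ^ (j + 1) * eulerSeries q (t * q ^ (j + 1)) := by
    have hterm : ∑' j, invPowProd 1 q j * y ^ (j + 1) * eulerSeries q (t * q ^ (j + 1)) =
        (1 - q) * eulerSeries q t * ∑' j, qBinomCoeff t q (j + 1) * y ^ (j + 1) := by
      rw [← tsum_mul_left]
      refine tsum_congr fun j => ?_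
      rw [← one_sub_mul_invPowProd_succ hq]
      linear_combination -(1 - q) * y ^ (j + 1) * qBinomCoeff_mul_eulerSeries hq ht (j + 1)
    rw [(summable_qBinomCoeff t hq hy).tsum_eq_zero_add, hterm]
    simp only [qBinomCoeff, Finset.range_zero, Finset.prod_empty, pow_zero]
    ring
  have h2 : (1 - q) * eulerSeries q t = 1 - q + ∑' k, invPowProd 1 q k * t ^ (k + 1) := by
    rw [eulerSeries_eq_one_add hq ht, mul_add, mul_one, ← tsum_mul_left]
    simp only [← one_sub_mul_invPowProd_succ hq, mul_assoc]
  rw [h1, h2, (summable_invPowProd_one hq ht).tsum_eq_zero_add,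
    (summable_invPowProd_one_mul_eulerSeries hq ht hy).tsum_eq_zero_add]
  simp only [zero_add, pow_one]
  rw [eulerSeries_eq_one_add hq htq]
  simp only [invPowProd, Finset.range_zero, Finset.prod_empty]
  ring

/-- The domain of absolute convergence of the crank generating function. -/
def CrankDomain (z q : ℂ) : Prop := z ≠ 0 ∧ ‖q‖ * max ‖z‖ ‖z‖⁻¹ < 1

namespace CrankDomain

variable {z q : ℂ}

lemma norm_mul_lt_one (h : CrankDomain z q) : ‖z * q‖ < 1 := by
  rw [norm_mul, mul_comm]
  exact (mul_le_mul_of_nonneg_left (le_max_left _ _) (norm_nonneg q)).trans_lt h.2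

lemma norm_inv_mul_lt_one (h : CrankDomain z q) : ‖z⁻¹ * q‖ < 1 := by
  rw [norm_mul, mul_comm, norm_inv]
  exact (mul_le_mul_of_nonneg_left (le_max_right _ _) (norm_nonneg q)).trans_lt h.2

lemma norm_lt_one (h : CrankDomain z q) : ‖q‖ < 1 := by
  have hz : (1 : ℝ) ≤ max ‖z‖ ‖z‖⁻¹ := by
    rcases le_total 1 ‖z‖ with hz | hz
    · exact le_max_of_le_left hz
    · exact le_max_of_le_right ((one_le_inv₀ (norm_pos_iff.mpr h.1)).mpr hz)
  exact (le_mul_of_one_le_right (norm_nonneg q) hz).trans_lt h.2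

lemma norm (h : CrankDomain z q) : CrankDomain (‖z‖ : ℂ) (‖q‖ : ℂ) :=
  ⟨by simpa using h.1, by simpa using h.2⟩

end CrankDomain

/-- `f z q` is, on the domain of absolute convergence, a sum of monomials `z ^ a * q ^ b`, with
finitely many monomials for each exponent of `q`. -/
def IsMonomialSum (f : ℂ → ℂ → ℂ) : Prop :=
  ∃ (ι : Type) (a : ι → ℤ) (b : ι → ℕ), (∀ n, {i | b i = n}.Finite) ∧
    ∀ z q, CrankDomain z q → HasSum (fun i => z ^ a i * q ^ b i) (f z q)

namespace IsMonomialSum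

variable {f g : ℂ → ℂ → ℂ}

lemma congr (hf : IsMonomialSum f) (h : ∀ z q, CrankDomain z q → f z q = g z q) :
    IsMonomialSum g := by
  obtain ⟨ι, a, b, hfin, hs⟩ := hf
  exact ⟨ι, a, b, hfin, fun z q hzq => h z q hzq ▸ hs z q hzq⟩

lemma monomial (a : ℤ) (b : ℕ) : IsMonomialSum fun z q => z ^ a * q ^ b :=
  ⟨Unit, fun _ => a, fun _ => b, fun _ => Set.toFinite _, fun _ _ _ => hasSum_unique _⟩

lemma zero : IsMonomialSum fun _ _ => 0 :=
  ⟨Empty, Empty.elim, Empty.elim, fun _ => Set.toFinite _, fun _ _ _ => hasSum_empty⟩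

lemma add (hf : IsMonomialSum f) (hg : IsMonomialSum g) :
    IsMonomialSum fun z q => f z q + g z q := by
  obtain ⟨ι, a, b, hfin, hs⟩ := hf
  obtain ⟨κ, a', b', hfin', hs'⟩ := hg
  refine ⟨ι ⊕ κ, Sum.elim a a', Sum.elim b b', fun n => ?_, fun z q hzq =>
    HasSum.sum (hs z q hzq) (hs' z q hzq)⟩
  refine (((hfin n).image Sum.inl).union ((hfin' n).image Sum.inr)).subset ?_
  rintro (i | i) hi
  · exact Or.inl ⟨i, hi, rfl⟩
  · exact Or.inr ⟨i, hi, rfl⟩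

lemma sum {α : Type*} (s : Finset α) {F : α → ℂ → ℂ → ℂ} (hF : ∀ i, IsMonomialSum (F i)) :
    IsMonomialSum fun z q => ∑ i ∈ s, F i z q := by
  classical
  induction s using Finset.induction_on with
  | empty => simpa using zero
  | insert i s hi ih => simpa [Finset.sum_insert hi] using (hF i).add ih

lemma mul (hf : IsMonomialSum f) (hg : IsMonomialSum g) :
    IsMonomialSum fun z q => f z q * g z q := by
  obtain ⟨ι, a, b, hfin, hs⟩ := hf
  obtain ⟨κ, a', b', hfin', hs'⟩ := hg
  refine ⟨ι × κ, fun p => a p.1 + a' p.2, fun p => b p.1 + b' p.2, fun n => ?_,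
    fun z q hzq => ?_⟩
  · have hle : (⋃ k ∈ Set.Iic n, {i | b i = k}).Finite :=
      (Set.finite_Iic n).biUnion fun k _ => hfin k
    have hle' : (⋃ k ∈ Set.Iic n, {i | b' i = k}).Finite :=
      (Set.finite_Iic n).biUnion fun k _ => hfin' k
    refine (hle.prod hle').subset ?_
    rintro ⟨i, j⟩ (hij : b i + b' j = n)
    simp only [Set.mem_prod, Set.mem_iUnion, Set.mem_Iic, Set.mem_ofPred_eq, exists_prop,
      exists_eq_right']
    omega
  · have h := hs z q hzq
    have h' := hs' z q hzq
    have hsum : Summable fun p : ι × κ => z ^ a p.1 * q ^ b p.1 * (z ^ a' p.2 * q ^ b' p.2) :=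
      summable_mul_of_summable_norm (f := fun i => z ^ a i * q ^ b i)
        (g := fun j => z ^ a' j * q ^ b' j) h.summable.norm h'.summable.norm
    refine (h.mul h' hsum).congr_fun fun p => ?_
    rw [zpow_add₀ hzq.1, pow_add]
    ring

/-- A convergent series `∑ q ^ j * F j` of monomial sums is a monomial sum. -/
lemma tsum {F : ℕ → ℂ → ℂ → ℂ} (hF : ∀ j, IsMonomialSum (F j))
    (hsum : ∀ z q, CrankDomain z q → Summable fun j => q ^ j * F j z q) :
    IsMonomialSum fun z q => ∑' j, q ^ j * F j z q := by
  choose ι a b hfin hs using hF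
  refine ⟨Σ j, ι j, fun p => a p.1 p.2, fun p => p.1 + b p.1 p.2, fun n => ?_,
    fun z q hzq => ?_⟩
  · have hle : ∀ j, (⋃ k ∈ Set.Iic n, {i | b j i = k}).Finite := fun j =>
      (Set.finite_Iic n).biUnion fun k _ => hfin j k
    refine ((Set.finite_Iic n).biUnion fun j _ => (hle j).image (Sigma.mk j)).subset ?_
    rintro ⟨j, i⟩ (hij : j + b j i = n)
    simp only [Set.mem_iUnion, Set.mem_Iic, exists_prop]
    refine ⟨j, by omega, i, ?_, rfl⟩
    simp only [Set.mem_iUnion, Set.mem_ofPred_eq, exists_prop, exists_eq_right']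
    omega
  · have hterm : ∀ w r : ℂ, CrankDomain w r → ∀ j,
        HasSum (fun i => w ^ a j i * r ^ (j + b j i)) (r ^ j * F j w r) := fun w r hwr j => by
      refine ((hs j w r hwr).mul_left (r ^ j)).congr_fun fun i => ?_
      rw [pow_add]
      ring
    refine HasSum.sigma_of_hasSum (hsum z q hzq).hasSum (hterm z q hzq) ?_
    refine Summable.of_norm ((summable_sigma_of_nonneg fun _ => norm_nonneg _).mpr
      ⟨fun j => (hterm z q hzq j).summable.norm, ?_⟩)
    rw [← Complex.summable_ofReal]
    refine (hsum _ _ hzq.norm).congr fun j => ?_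
    rw [Complex.ofReal_tsum, ← (hterm _ _ hzq.norm j).tsum_eq]
    simp

lemma inv_one_sub_pow (s : ℕ) : IsMonomialSum fun _ q => (1 - q ^ (s + 1))⁻¹ := by
  refine ⟨ℕ, fun _ => 0, fun n => (s + 1) * n, fun n => ?_, fun z q hzq => ?_⟩
  · refine (Set.finite_Iic n).subset fun i (hi : (s + 1) * i = n) => ?_
    rw [Set.mem_Iic]
    nlinarith
  · simp only [zpow_zero, one_mul, pow_mul]
    apply hasSum_geometric_of_norm_lt_one
    rw [norm_pow]
    exact pow_lt_one₀ (norm_nonneg _) hzq.norm_lt_one (Nat.succ_ne_zero s)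

lemma invPowProd (s k : ℕ) : IsMonomialSum fun _ q => invPowProd s q k := by
  induction k with
  | zero => simpa [_root_.invPowProd] using monomial 0 0
  | succ k ih =>
    simpa only [_root_.invPowProd, Finset.prod_range_succ] using ih.mul (inv_one_sub_pow (k + s))

/-- A monomial sum has nonnegative coefficients as a Laurent series. -/
lemma exists_coeff (hf : IsMonomialSum f) :
    ∃ c : ℕ → (ℤ →₀ ℝ), (∀ n : ℕ, ∀ k : ℤ, 0 ≤ c n k) ∧
      ∀ z q : ℂ, CrankDomain z q →
        f z q = ∑' n : ℕ, ((c n).sum fun k r => (r : ℂ) * z ^ k) * q ^ n := by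
  obtain ⟨ι, a, b, hfin, hs⟩ := hf
  refine ⟨fun n => ∑ i ∈ (hfin n).toFinset, Finsupp.single (a i) 1, fun n k => ?_,
    fun z q hzq => ?_⟩
  · rw [Finsupp.finsetSum_apply]
    refine Finset.sum_nonneg fun i _ => ?_
    rw [Finsupp.single_apply]
    split_ifs <;> norm_num
  · rw [← ((hs z q hzq).tsum_fiberwise b).tsum_eq]
    congr 1
    ext n
    rw [← Finsupp.sum_finsetSum_index (by simp) (by intros; push_cast; ring), Finset.sum_mul]
    have hset : b ⁻¹' {n} = ((hfin n).toFinset : Set ι) := by ext; simp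
    rw [hset, Finset.tsum_subtype' (hfin n).toFinset fun i => z ^ a i * q ^ b i]
    refine Finset.sum_congr rfl fun i hi => ?_
    rw [Finsupp.sum_single_index (by simp), (hfin n).mem_toFinset.mp hi]
    simp

end IsMonomialSum

lemma isMonomialSum_eulerSeries (s : ℕ) :
    IsMonomialSum fun z q => eulerSeries q (z * q * q ^ s) := by
  have key : ∀ z q : ℂ, ∀ k : ℕ, q ^ k * (invPowProd 0 q k * (z ^ (k : ℤ) * q ^ (s * k))) =
      invPowProd 0 q k * (z * q * q ^ s) ^ k := fun z q k => by
    rw [zpow_natCast]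
    ring
  refine (IsMonomialSum.tsum
    (fun k => (IsMonomialSum.invPowProd 0 k).mul (.monomial (k : ℤ) (s * k)))
    fun z q hzq => ?_).congr fun z q hzq => ?_
  · simp only [key]
    exact summable_invPowProd hzq.norm_lt_one
      (norm_mul_pow_lt_one hzq.norm_lt_one hzq.norm_mul_lt_one s)
  · simp only [key, eulerSeries]

lemma isMonomialSum_tsum_mul_pow_add_two :
    IsMonomialSum fun z q => ∑' k, invPowProd 1 q (k + 1) * (z * q) ^ (k + 2) := by
  have key : ∀ z q : ℂ, ∀ k : ℕ,
      q ^ k * (invPowProd 1 q (k + 1) * (z ^ ((k + 2 : ℕ) : ℤ) * q ^ 2)) =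
        invPowProd 1 q (k + 1) * (z * q) ^ (k + 2) := fun z q k => by
    rw [zpow_natCast]
    ring
  refine (IsMonomialSum.tsum
    (fun k => (IsMonomialSum.invPowProd 1 (k + 1)).mul (.monomial ((k + 2 : ℕ) : ℤ) 2))
    fun z q hzq => ?_).congr fun z q hzq => ?_
  · simp only [key]
    exact (summable_nat_add_iff 1).mpr
      (summable_invPowProd_one hzq.norm_lt_one hzq.norm_mul_lt_one)
  · simp only [key]

lemma isMonomialSum_inv_mul_tsum :
    IsMonomialSum fun z q =>
      z⁻¹ * q * ∑' k, invPowProd 0 q (k + 1) * (z * q * q) ^ (k + 1) := by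
  have key : ∀ z q : ℂ, CrankDomain z q → ∀ k : ℕ,
      q ^ k * (invPowProd 0 q (k + 1) * (z ^ (k : ℤ) * q ^ (k + 3))) =
        z⁻¹ * q * (invPowProd 0 q (k + 1) * (z * q * q) ^ (k + 1)) := fun z q hzq k => by
    have := hzq.1
    rw [zpow_natCast, pow_succ (z * q * q)]
    field_simp
    ring
  refine (IsMonomialSum.tsum
    (fun k => (IsMonomialSum.invPowProd 0 (k + 1)).mul (.monomial (k : ℤ) (k + 3)))
    fun z q hzq => ?_).congr fun z q hzq => ?_
  · simp only [key z q hzq]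
    refine ((summable_nat_add_iff 1).mpr (summable_invPowProd hzq.norm_lt_one ?_)).mul_left _
    simpa using norm_mul_pow_lt_one hzq.norm_lt_one hzq.norm_mul_lt_one 1
  · simp only [key z q hzq, tsum_mul_left]

lemma isMonomialSum_tsum_mul_eulerSeries :
    IsMonomialSum fun z q =>
      ∑' j, invPowProd 1 q (j + 1) * (z⁻¹ * q) ^ (j + 2) * eulerSeries q (z * q * q ^ (j + 2)) := by
  have key : ∀ z q : ℂ, ∀ j : ℕ,
      q ^ j * (invPowProd 1 q (j + 1) * (z ^ (-((j + 2 : ℕ) : ℤ)) * q ^ 2) *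
          eulerSeries q (z * q * q ^ (j + 2))) =
        invPowProd 1 q (j + 1) * (z⁻¹ * q) ^ (j + 2) *
          eulerSeries q (z * q * q ^ (j + 2)) := fun z q j => by
    rw [zpow_neg, zpow_natCast]
    ring
  refine (IsMonomialSum.tsum
    (fun j => ((IsMonomialSum.invPowProd 1 (j + 1)).mul
      (.monomial (-((j + 2 : ℕ) : ℤ)) 2)).mul (isMonomialSum_eulerSeries (j + 2)))
    fun z q hzq => ?_).congr fun z q hzq => ?_
  · simp only [key]
    exact (summable_nat_add_iff 1).mpr (summable_invPowProd_one_mul_eulerSeries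
      hzq.norm_lt_one hzq.norm_mul_lt_one hzq.norm_inv_mul_lt_one)
  · simp only [key]

lemma geom_sum_mul_add_inv_sub_one {z : ℂ} (hz : z ≠ 0) (n : ℕ) :
    (∑ i ∈ Finset.range (n + 2), z ^ i) * (z + z⁻¹ - 1) =
      z⁻¹ + z ^ (n + 2) + ∑ i ∈ Finset.range n, z ^ (i + 1) := by
  induction n with
  | zero =>
    simp only [Finset.sum_range_succ, Finset.sum_range_zero]
    field_simp
    ring
  | succ n ih =>
    rw [Finset.sum_range_succ, add_mul, ih, Finset.sum_range_succ]
    field_simp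
    ring

/-- Proposition (crank nonnegativity): for any integer `m ≥ 2`, the series
`(1 + z + ⋯ + z^{m-1}) ∏_{n ≥ 1} (1-qⁿ)/((1-zqⁿ)(1-z⁻¹qⁿ))`
has nonnegative coefficients, as a Laurent series in `z` whose coefficient of
`qⁿ` is a Laurent polynomial in `z`.  The coefficients are recorded by a
finitely supported family `c n : ℤ →₀ ℝ`, and the equality with the analytic
function holds on a region of absolute convergence. -/
theorem crank_poly_nonneg (m : ℕ) (hm : 2 ≤ m) :
    ∃ c : ℕ → (ℤ →₀ ℝ), (∀ n : ℕ, ∀ k : ℤ, 0 ≤ c n k) ∧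
      ∀ z q : ℂ, z ≠ 0 → ‖q‖ * max ‖z‖ ‖z‖⁻¹ < 1 →
        (∑ i ∈ Finset.range m, z ^ i) *
            ∏' n : ℕ, (1 - q ^ (n + 1)) /
              ((1 - z * q ^ (n + 1)) * (1 - z⁻¹ * q ^ (n + 1))) =
          ∑' n : ℕ, ((c n).sum fun k r => (r : ℂ) * z ^ k) * q ^ n := by
  obtain ⟨n, rfl⟩ := Nat.exists_eq_add_of_le' hm
  have hS : IsMonomialSum fun z _ => ∑ i ∈ Finset.range (n + 2), z ^ i :=
    (IsMonomialSum.sum (Finset.range (n + 2)) fun i : ℕ => .monomial (i : ℤ) 0).congr fun z q _ => by simp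
  have hT : IsMonomialSum fun z q =>
      (∑ i ∈ Finset.range (n + 2), z ^ i) * ((z + z⁻¹ - 1) * q) := by
    refine (((IsMonomialSum.monomial (-1) 1).add (.monomial ((n + 2 : ℕ) : ℤ) 1)).add
      (.sum (Finset.range n) fun i : ℕ => .monomial ((i + 1 : ℕ) : ℤ) 1)).congr
      fun z q hzq => ?_
    rw [← mul_assoc, geom_sum_mul_add_inv_sub_one hzq.1]
    simp only [zpow_natCast, zpow_neg_one, pow_one, ← Finset.sum_mul]
    ring
  have hF := (hS.add hT).add (hS.mul
    ((isMonomialSum_tsum_mul_pow_add_two.add isMonomialSum_inv_mul_tsum).add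
      isMonomialSum_tsum_mul_eulerSeries))
  obtain ⟨c, hc, h⟩ := hF.exists_coeff
  refine ⟨c, hc, fun z q hz hq => ?_⟩
  have hzq : CrankDomain z q := ⟨hz, hq⟩
  rw [← h z q hzq, crank_tprod_eq hz hzq.norm_lt_one hzq.norm_mul_lt_one hzq.norm_inv_mul_lt_one]
  have hser := crank_series_eq hzq.norm_lt_one hzq.norm_mul_lt_one hzq.norm_inv_mul_lt_one
  simp only [qBinomCoeff_zero_eq]
  rw [← eulerSeries, hser]
  ring
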